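/- arXiv:2402.18993 — 3 statements merged into one kernel-verified Lean document; each statement's English description precedes it below -/
import Mathlib

section
/- Let a ∈ ℝ and let M : ℝ → ℝ be differentiable. For v ∈ ℝ, r > 0, ϑ ∈ (0,π), let g(v,r,ϑ) be the Kerr–Vaidya metric matrix and g₀(r,ϑ) the flat oblate-spheroidal metric matrix in ingoing coordinates (both are invertible 4×4 real matrices, each having determinant −ρ⁴·sin²ϑ ≠ 0). Define the extrinsic–curvature trace of the constant-r surface by the coordinate divergence formula K_g(v,r,ϑ) := (ρ²·sinϑ)⁻¹·[∂_v(ρ²·sinϑ·(g⁻¹)₀₁) + ∂_r(ρ²·sinϑ·(g⁻¹)₁₁) + ∂_ϑ(ρ²·sinϑ·(g⁻¹)₂₁)], and K₀(r,ϑ) by the same formula with g replaced by g₀ (no entry depends on the fourth coordinate ψ, so the ∂_ψ term vanishes). Then the Brown–York quasi-local mass of Kerr–Vaidya spacetime equals the dynamical mass: for every v ∈ ℝ and r > 0, (1/(8π)) · ∫₀^{2π} ∫₀^{π} (K₀(r,ϑ) − K_g(v,r,ϑ)) · ρ² · sinϑ dϑ dψ = M(v). -/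
noncomputable section

open Real MeasureTheory

/-- ρ² = r² + a²·cos²ϑ. -/
def rho2 (a r θ : ℝ) : ℝ := r ^ 2 + a ^ 2 * Real.cos θ ^ 2

/-- The Kerr–Vaidya metric matrix in ingoing Eddington–Finkelstein-type coordinates
`(v,r,ϑ,ψ)`, for mass function `M` and rotation parameter `a`. -/
def kerrVaidyaMatrix (a : ℝ) (M : ℝ → ℝ) (v r θ : ℝ) : Matrix (Fin 4) (Fin 4) ℝ :=
  !![-(1 - 2 * M v * r / rho2 a r θ), 1, 0,
       -(2 * M v * a * r * Real.sin θ ^ 2 / rho2 a r θ);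
     1, 0, 0, -(a * Real.sin θ ^ 2);
     0, 0, rho2 a r θ, 0;
     -(2 * M v * a * r * Real.sin θ ^ 2 / rho2 a r θ), -(a * Real.sin θ ^ 2), 0,
       ((r ^ 2 + a ^ 2) ^ 2
           - (r ^ 2 - 2 * M v * r + a ^ 2) * a ^ 2 * Real.sin θ ^ 2)
         * Real.sin θ ^ 2 / rho2 a r θ]

/-- The flat oblate-spheroidal metric matrix in ingoing coordinates `(v,r,ϑ,ψ)`. -/
def flatOblateMatrix (a r θ : ℝ) : Matrix (Fin 4) (Fin 4) ℝ :=
  !![-1, 1, 0, 0;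
     1, 0, 0, -(a * Real.sin θ ^ 2);
     0, 0, rho2 a r θ, 0;
     0, -(a * Real.sin θ ^ 2), 0, (r ^ 2 + a ^ 2) * Real.sin θ ^ 2]

/-- The trace `K_g` of the extrinsic curvature of the constant-`r` surface embedded in
Kerr–Vaidya spacetime, computed by the coordinate divergence formula
`K_g = (ρ²sinϑ)⁻¹·[∂_v(ρ²sinϑ·(g⁻¹)₀₁) + ∂_r(ρ²sinϑ·(g⁻¹)₁₁) + ∂_ϑ(ρ²sinϑ·(g⁻¹)₂₁)]`. -/
def Kg (a : ℝ) (M : ℝ → ℝ) (v r θ : ℝ) : ℝ :=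
  (rho2 a r θ * Real.sin θ)⁻¹ *
    (deriv (fun v' => rho2 a r θ * Real.sin θ * (kerrVaidyaMatrix a M v' r θ)⁻¹ 0 1) v
      + deriv (fun r' => rho2 a r' θ * Real.sin θ * (kerrVaidyaMatrix a M v r' θ)⁻¹ 1 1) r
      + deriv (fun θ' => rho2 a r θ' * Real.sin θ' * (kerrVaidyaMatrix a M v r θ')⁻¹ 2 1) θ)

/-- The trace `K₀` of the extrinsic curvature of the constant-`r` surface embedded
isometrically in flat spacetime, computed by the same coordinate divergence formula with
`g` replaced by the flat oblate-spheroidal metric `g₀` (which does not depend on `v`). -/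
def K0 (a r θ : ℝ) : ℝ :=
  (rho2 a r θ * Real.sin θ)⁻¹ *
    (deriv (fun _v : ℝ => rho2 a r θ * Real.sin θ * (flatOblateMatrix a r θ)⁻¹ 0 1) 0
      + deriv (fun r' => rho2 a r' θ * Real.sin θ * (flatOblateMatrix a r' θ)⁻¹ 1 1) r
      + deriv (fun θ' => rho2 a r θ' * Real.sin θ' * (flatOblateMatrix a r θ')⁻¹ 2 1) θ)

lemma rho2_pos {a r : ℝ} (hr : 0 < r) (θ : ℝ) : 0 < rho2 a r θ := by
  unfold rho2
  positivity

/-- The explicit inverse of the Kerr–Vaidya metric matrix. -/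
lemma kerrVaidyaMatrix_inv {a r θ : ℝ} (M : ℝ → ℝ) (v : ℝ) (hr : 0 < r)
    (hθ : Real.sin θ ≠ 0) :
    (kerrVaidyaMatrix a M v r θ)⁻¹ =
      !![a ^ 2 * Real.sin θ ^ 2 / rho2 a r θ, (r ^ 2 + a ^ 2) / rho2 a r θ, 0, a / rho2 a r θ;
         (r ^ 2 + a ^ 2) / rho2 a r θ, (r ^ 2 - 2 * M v * r + a ^ 2) / rho2 a r θ, 0,
           a / rho2 a r θ;
         0, 0, 1 / rho2 a r θ, 0;
         a / rho2 a r θ, a / rho2 a r θ, 0, 1 / (rho2 a r θ * Real.sin θ ^ 2)] := by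
  have hρ := (rho2_pos (a := a) hr θ).ne'
  have hc : rho2 a r θ = r ^ 2 + a ^ 2 - a ^ 2 * Real.sin θ ^ 2 := by
    rw [rho2, Real.cos_sq']
    ring
  apply Matrix.inv_eq_right_inv
  ext i j
  fin_cases i <;> fin_cases j <;>
    simp [kerrVaidyaMatrix, Matrix.mul_apply, Fin.sum_univ_four] <;>
    field_simp <;> (try rw [hc]) <;> ring

/-- The flat metric is the massless Kerr–Vaidya metric. -/
lemma flatOblateMatrix_eq_kerrVaidyaMatrix {a r : ℝ} (v θ : ℝ) (hr : 0 < r) :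
    flatOblateMatrix a r θ = kerrVaidyaMatrix a 0 v r θ := by
  have hρ := (rho2_pos (a := a) hr θ).ne'
  have hc : rho2 a r θ = r ^ 2 + a ^ 2 - a ^ 2 * Real.sin θ ^ 2 := by
    rw [rho2, Real.cos_sq']
    ring
  have h33 : (r ^ 2 + a ^ 2) * Real.sin θ ^ 2 =
      ((r ^ 2 + a ^ 2) ^ 2 - (r ^ 2 + a ^ 2) * a ^ 2 * Real.sin θ ^ 2) * Real.sin θ ^ 2
        / rho2 a r θ := by
    rw [eq_div_iff hρ, hc]
    ring
  simp [flatOblateMatrix, kerrVaidyaMatrix, h33]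

lemma K0_eq_Kg_zero {a r : ℝ} (v θ : ℝ) (hr : 0 < r) : K0 a r θ = Kg a 0 v r θ := by
  have hderiv : deriv (fun r' => rho2 a r' θ * Real.sin θ * (flatOblateMatrix a r' θ)⁻¹ 1 1) r =
      deriv (fun r' => rho2 a r' θ * Real.sin θ * (kerrVaidyaMatrix a 0 v r' θ)⁻¹ 1 1) r := by
    apply Filter.EventuallyEq.deriv_eq
    filter_upwards [lt_mem_nhds hr] with r' hr'
    rw [flatOblateMatrix_eq_kerrVaidyaMatrix v θ hr']
  have hconst : ∀ v', kerrVaidyaMatrix a 0 v' r θ = kerrVaidyaMatrix a 0 v r θ := fun _ => rfl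
  simp only [K0, Kg, hderiv, flatOblateMatrix_eq_kerrVaidyaMatrix v _ hr, hconst, deriv_const]

/-- The densitized trace of the extrinsic curvature is `∂_r Δ · sinϑ`. -/
lemma Kg_mul_density {a r θ : ℝ} (M : ℝ → ℝ) (v : ℝ) (hr : 0 < r) (hθ : Real.sin θ ≠ 0) :
    Kg a M v r θ * (rho2 a r θ * Real.sin θ) = (2 * r - 2 * M v) * Real.sin θ := by
  have hρ := (rho2_pos (a := a) hr θ).ne'
  have hv : deriv (fun v' => rho2 a r θ * Real.sin θ * (kerrVaidyaMatrix a M v' r θ)⁻¹ 0 1) v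
      = 0 := by
    simp [kerrVaidyaMatrix_inv M _ hr hθ]
  have hϑ : deriv (fun θ' => rho2 a r θ' * Real.sin θ' * (kerrVaidyaMatrix a M v r θ')⁻¹ 2 1) θ
      = 0 := by
    rw [← deriv_const θ (0 : ℝ)]
    apply Filter.EventuallyEq.deriv_eq
    filter_upwards [Real.continuous_sin.continuousAt.eventually_ne hθ] with θ' hθ'
    simp [kerrVaidyaMatrix_inv M v hr hθ']
  have hr_deriv :
      deriv (fun r' => rho2 a r' θ * Real.sin θ * (kerrVaidyaMatrix a M v r' θ)⁻¹ 1 1) r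
        = (2 * r - 2 * M v) * Real.sin θ := by
    have heq : (fun r' => rho2 a r' θ * Real.sin θ * (kerrVaidyaMatrix a M v r' θ)⁻¹ 1 1)
        =ᶠ[nhds r] fun r' => (r' ^ 2 - 2 * M v * r' + a ^ 2) * Real.sin θ := by
      filter_upwards [lt_mem_nhds hr] with r' hr'
      have hρ' := (rho2_pos (a := a) hr' θ).ne'
      simp [kerrVaidyaMatrix_inv M v hr' hθ]
      field_simp
    rw [heq.deriv_eq]
    have h := ((((hasDerivAt_id' r).pow 2).sub ((hasDerivAt_id' r).const_mul (2 * M v))).add_const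
      (a ^ 2)).mul_const (Real.sin θ)
    exact h.deriv.trans (by norm_num)
  rw [Kg, hv, hϑ, hr_deriv]
  field_simp
  ring

/-- The Brown–York quasi-local mass of Kerr–Vaidya spacetime equals the dynamical mass:
`(1/(8π))·∫₀^{2π}∫₀^{π} (K₀ − K_g)·ρ²·sinϑ dϑ dψ = M(v)` for every `v` and `r > 0`. -/
theorem brownYork_mass_kerrVaidya (a : ℝ) (M : ℝ → ℝ) (hM : Differentiable ℝ M) :
    ∀ (v r : ℝ), 0 < r →
      1 / (8 * π) *
          ∫ _ψ in (0:ℝ)..(2 * π), ∫ θ in (0:ℝ)..π,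
            (K0 a r θ - Kg a M v r θ) * (rho2 a r θ * Real.sin θ)
        = M v := by
  intro v r hr
  have hdensity : ∀ θ, (K0 a r θ - Kg a M v r θ) * (rho2 a r θ * Real.sin θ)
      = 2 * M v * Real.sin θ := by
    intro θ
    by_cases hθ : Real.sin θ = 0
    · simp [hθ]
    · rw [K0_eq_Kg_zero v θ hr, sub_mul, Kg_mul_density 0 v hr hθ, Kg_mul_density M v hr hθ]
      simp only [Pi.zero_apply]
      ring
  simp only [hdensity, intervalIntegral.integral_const_mul, integral_sin,
    intervalIntegral.integral_const, Real.cos_zero, Real.cos_pi, smul_eq_mul]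
  field_simp
  ring
end
end

section
/- For every a ≠ 0, the function q(r) := ((r² + a²)/(2a))·arctan(a/r) − r/2 tends to 0 as r → ∞. Consequently the Noether charge Q_K = M(v) − M′(v)·q(r) of the Kodama-like current in Kerr–Vaidya spacetime converges to the Brown–York mass M(v) in the asymptotically flat region r → ∞. -/
noncomputable section

open Real Filter

/-- The deviation of the Kodama-like Noether charge of Kerr–Vaidya spacetime
from the dynamical mass, per unit of `M′(v)`. -/
def qKV (a r : ℝ) : ℝ := (r ^ 2 + a ^ 2) / (2 * a) * Real.arctan (a / r) - r / 2

/-- The numerator has derivative `2 y arctan y`, so the limit is that of `arctan y`. -/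
theorem tendsto_one_add_sq_mul_arctan_sub_div_sq :
    Tendsto (fun y : ℝ => ((1 + y ^ 2) * Real.arctan y - y) / y ^ 2) (nhdsWithin 0 {0}ᶜ)
      (nhds 0) := by
  have hnum (y : ℝ) : HasDerivAt (fun y : ℝ => (1 + y ^ 2) * Real.arctan y - y)
      (2 * y * Real.arctan y) y := by
    have hy : (1 + y ^ 2) ≠ 0 := by positivity
    refine ((((hasDerivAt_pow 2 y).const_add 1).mul (Real.hasDerivAt_arctan y)).sub
      (hasDerivAt_id y)).congr_deriv ?_
    simp [hy]
  have hden (y : ℝ) : HasDerivAt (fun y : ℝ => y ^ 2) (2 * y) y := by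
    simpa using hasDerivAt_pow 2 y
  have hne : ∀ᶠ y : ℝ in nhdsWithin 0 {0}ᶜ, y ≠ 0 := self_mem_nhdsWithin
  refine HasDerivAt.lhopital_zero_nhdsNE (.of_forall hnum) (.of_forall hden)
    (hne.mono fun y hy => mul_ne_zero two_ne_zero hy) ?_ ?_ ?_
  · simpa using (hnum 0).continuousAt.tendsto.mono_left nhdsWithin_le_nhds
  · simpa using (hden 0).continuousAt.tendsto.mono_left nhdsWithin_le_nhds
  · have harctan : Tendsto Real.arctan (nhdsWithin 0 {0}ᶜ) (nhds 0) := by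
      simpa using Real.continuous_arctan.continuousAt.tendsto.mono_left
        (nhdsWithin_le_nhds (a := (0 : ℝ)) (s := {0}ᶜ))
    refine harctan.congr' (hne.mono fun y hy => ?_)
    field_simp

theorem qKV_eq {a r : ℝ} (ha : a ≠ 0) (hr : r ≠ 0) :
    qKV a r = a / 2 * (((1 + (a / r) ^ 2) * Real.arctan (a / r) - a / r) / (a / r) ^ 2) := by
  unfold qKV
  field_simp

/-- For every `a ≠ 0`, `q(r) → 0` as `r → ∞`; consequently the Noether charge
`Q_K = M(v) − M′(v)·q(r)` of the Kodama-like current in Kerr–Vaidya spacetime converges to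
the Brown–York mass `M(v)` in the asymptotically flat region. -/
theorem qKV_tendsto_zero (a : ℝ) (ha : a ≠ 0) :
    Tendsto (fun r : ℝ => qKV a r) atTop (nhds 0) ∧
      ∀ (M : ℝ → ℝ) (v : ℝ),
        Tendsto (fun r : ℝ => M v - deriv M v * qKV a r) atTop (nhds (M v)) := by
  have hq : Tendsto (fun r : ℝ => qKV a r) atTop (nhds 0) := by
    have hdiv : Tendsto (fun r : ℝ => a / r) atTop (nhdsWithin 0 {0}ᶜ) :=
      tendsto_nhdsWithin_iff.2 ⟨tendsto_const_nhds.div_atTop tendsto_id,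
        (eventually_ne_atTop 0).mono fun r hr => div_ne_zero ha hr⟩
    have hlim := (tendsto_one_add_sq_mul_arctan_sub_div_sq.comp hdiv).const_mul (a / 2)
    rw [mul_zero] at hlim
    exact hlim.congr' ((eventually_ne_atTop 0).mono fun r hr => (qKV_eq ha hr).symm)
  refine ⟨hq, fun M v => ?_⟩
  simpa using (hq.const_mul (deriv M v)).const_sub (M v)
end
end

section
/- Let a ≠ 0 and let r be a real number with r > |a|. Then the series Σ_{n=0}^{∞} 4a² · (−1)ⁿ / ((2n+1)·(2n+3)·(2n+5)) · (a/r)^{2n+1} converges, and its sum equals ℓ(r) := ((r² + a²)²/(2a²))·arctan(a/r) − r³/(2a) − 5·a·r/6 (the Laurent expansion of ℓ about r = ∞). -/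
noncomputable section

open Real

/-- The deviation of the angular-momentum Noether charge of Kerr–Vaidya spacetime
from `M(v)·a`, per unit of `M′(v)`. -/
def ellKV (a r : ℝ) : ℝ :=
  (r ^ 2 + a ^ 2) ^ 2 / (2 * a ^ 2) * Real.arctan (a / r) - r ^ 3 / (2 * a) - 5 * a * r / 6

/-- For `a ≠ 0` and `r > |a|`, the Laurent series
`Σₙ 4a²·(−1)ⁿ/((2n+1)(2n+3)(2n+5))·(a/r)^{2n+1}` converges with sum `ℓ(r)`. -/
theorem ellKV_laurent_expansion (a r : ℝ) (ha : a ≠ 0) (hr : |a| < r) :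
    HasSum
      (fun n : ℕ =>
        4 * a ^ 2 * (-1 : ℝ) ^ n / ((2 * (n : ℝ) + 1) * (2 * (n : ℝ) + 3) * (2 * (n : ℝ) + 5))
          * (a / r) ^ (2 * n + 1))
      (ellKV a r) := by
  have hr0 : r ≠ 0 := ((abs_nonneg a).trans_lt hr).ne'
  have hx : ‖a / r‖ < 1 := by
    have hrpos : 0 < r := (abs_nonneg a).trans_lt hr
    rwa [Real.norm_eq_abs, abs_div, abs_of_pos hrpos, div_lt_one hrpos]
  have h0 := Real.hasSum_arctan hx
  have h1 := (hasSum_nat_add_iff' 1).mpr h0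
  have h2 := (hasSum_nat_add_iff' 2).mpr h0
  have key := ((h0.mul_left (a ^ 2 / 2)).add (h1.mul_left (r ^ 2))).add
    (h2.mul_left (r ^ 4 / (2 * a ^ 2)))
  refine (congrArg₂ (fun f s => HasSum (α := ℝ) (β := ℕ) f s) (funext fun n => ?_) ?_).mp key
  · have hn1 : (2 * (n : ℝ) + 1) ≠ 0 := by positivity
    have hn3 : (2 * (n : ℝ) + 3) ≠ 0 := by positivity
    have hn5 : (2 * (n : ℝ) + 5) ≠ 0 := by positivity
    have e1 : (((2 * (n + 1) + 1 : ℕ)) : ℝ) = 2 * (n : ℝ) + 3 := by push_cast; ring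
    have e2 : (((2 * (n + 2) + 1 : ℕ)) : ℝ) = 2 * (n : ℝ) + 5 := by push_cast; ring
    have p1 : (a / r) ^ (2 * (n + 1) + 1) = (a / r) ^ (2 * n + 1) * (a ^ 2 / r ^ 2) := by
      rw [← div_pow]; ring
    have p2 : (a / r) ^ (2 * (n + 2) + 1) = (a / r) ^ (2 * n + 1) * (a ^ 4 / r ^ 4) := by
      rw [← div_pow]; ring
    rw [e1, e2, p1, p2, pow_succ (-1 : ℝ) n, pow_add (-1 : ℝ) n 2]
    push_cast
    generalize (a / r) ^ (2 * n + 1) = y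
    generalize (-1 : ℝ) ^ n = s
    field_simp
    ring
  · simp only [ellKV, Finset.sum_range_succ, Finset.sum_range_zero]
    generalize Real.arctan (a / r) = A
    norm_num
    field_simp
    ring
end
end
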